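/- ∫₀¹ (1-x)/(1-x⁶)·log⁶(x) dx = 7(256√3·π⁷ + 1327995·ζ(7))/26244. -/

import Mathlib

open MeasureTheory Set

lemma aux_image : (fun t : ℝ => Real.exp (-t)) '' Ioi 0 = Ioo 0 1 := by
  ext x
  constructor
  · rintro ⟨t, ht, rfl⟩
    exact ⟨Real.exp_pos _, by simpa using ht⟩
  · rintro ⟨h0, h1⟩
    refine ⟨-Real.log x, ?_, ?_⟩
    · have := Real.log_neg h0 h1
      simpa using this
    · simp [Real.exp_log h0]

lemma aux_int (m : ℕ) :
    ∫ x in Ioo (0:ℝ) 1, x ^ m * Real.log x ^ 6 = 720 / ((m:ℝ) + 1) ^ 7 := by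
  rw [← aux_image, integral_image_eq_integral_abs_deriv_smul (f' := fun t => -Real.exp (-t))
    measurableSet_Ioi]
  · have h := Real.integral_rpow_mul_exp_neg_mul_Ioi (a := 7) (r := (m:ℝ) + 1) (by norm_num)
      (by positivity)
    have hG : Real.Gamma 7 = 720 := by
      have := Real.Gamma_nat_eq_factorial 6
      rw [show (((6:ℕ):ℝ) + 1) = 7 by norm_num] at this
      rw [this]; norm_num [Nat.factorial]
    rw [hG] at h
    have e : ((1 / ((m:ℝ) + 1)) ^ (7:ℝ) * 720) = 720 / ((m:ℝ) + 1) ^ 7 := by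
      rw [show (7:ℝ) = ((7:ℕ):ℝ) by norm_num, Real.rpow_natCast]
      field_simp
    rw [← e, ← h]
    refine setIntegral_congr_fun measurableSet_Ioi (fun t ht => ?_)
    have h6 : t ^ ((7:ℝ) - 1) = t ^ 6 := by
      rw [show (7:ℝ) - 1 = ((6:ℕ):ℝ) by norm_num, Real.rpow_natCast]
    simp only [smul_eq_mul, abs_neg, Real.abs_exp, Real.log_exp, h6]
    rw [← Real.exp_nat_mul, ← mul_assoc, ← Real.exp_add, mul_comm]
    congr 1
    · ring
    · congr 1; ring
  · intro t _
    have := ((hasDerivAt_id t).neg.exp).hasDerivWithinAt (s := Ioi 0)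
    simpa using this
  · intro a _ b _ h
    simpa using h

lemma aux_integrable (m : ℕ) :
    IntegrableOn (fun x : ℝ => x ^ m * Real.log x ^ 6) (Ioo 0 1) := by
  by_contra h
  have h1 := aux_int m
  rw [integral_undef h] at h1
  have : 0 < 720 / ((m:ℝ) + 1) ^ 7 := by positivity
  linarith

noncomputable def aux_u (n : ℕ) : ℝ := 1 / (n:ℝ) ^ 7

lemma aux_u_summable : Summable aux_u :=
  Real.summable_one_div_nat_pow.mpr (by norm_num)

lemma aux_u_summable' (j : ℕ) : Summable (fun m => aux_u (j + 6 * m)) :=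
  aux_u_summable.comp_injective (fun a b h => by simpa using h)

lemma aux_integral : ∫ x in (0:ℝ)..1, (1 - x) / (1 - x ^ 6) * Real.log x ^ 6 =
    720 * (∑' m, aux_u (1 + 6 * m) - ∑' m, aux_u (2 + 6 * m)) := by
  rw [intervalIntegral.integral_of_le zero_le_one, integral_Ioc_eq_integral_Ioo]
  let F : ℕ → ℝ → ℝ := fun n x => x ^ (6 * n) * Real.log x ^ 6 - x ^ (6 * n + 1) * Real.log x ^ 6
  have hFi : ∀ n, Integrable (F n) (volume.restrict (Ioo 0 1)) := fun n =>
    (aux_integrable _).sub (aux_integrable _)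
  have hFv : ∀ n, ∫ x in Ioo (0:ℝ) 1, F n x =
      720 * (aux_u (1 + 6 * n) - aux_u (2 + 6 * n)) := by
    intro n
    rw [integral_sub (aux_integrable _) (aux_integrable _), aux_int, aux_int]
    simp only [aux_u]
    push_cast
    rw [show (6 * (n:ℝ) + 1 + 1) = 2 + 6 * n by ring, show (6 * (n:ℝ) + 1) = 1 + 6 * n by ring]
    ring
  have hFn : ∀ n, ∫ x in Ioo (0:ℝ) 1, ‖F n x‖ = ∫ x in Ioo (0:ℝ) 1, F n x := by
    intro n
    refine setIntegral_congr_fun measurableSet_Ioo (fun x hx => ?_)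
    have : F n x = x ^ (6 * n) * (1 - x) * Real.log x ^ 6 := by simp only [F]; ring
    simp only [this]
    apply Real.norm_of_nonneg
    have h0 := hx.1.le
    have h1 : 0 ≤ 1 - x := by linarith [hx.2]
    positivity
  have hs : Summable (fun n => 720 * (aux_u (1 + 6 * n) - aux_u (2 + 6 * n))) :=
    ((aux_u_summable' 1).sub (aux_u_summable' 2)).mul_left _
  have key := hasSum_integral_of_summable_integral_norm hFi (by simpa only [hFn, hFv] using hs)
  simp only [hFv] at key
  rw [← (aux_u_summable' 1).tsum_sub (aux_u_summable' 2), ← tsum_mul_left, key.tsum_eq]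
  refine setIntegral_congr_fun measurableSet_Ioo (fun x hx => ?_)
  have h6 : x ^ 6 < 1 := pow_lt_one₀ hx.1.le hx.2 (by norm_num)
  have hg := (hasSum_geometric_of_lt_one (pow_nonneg hx.1.le 6) h6).mul_left
    ((1 - x) * Real.log x ^ 6)
  have : (fun n => F n x) = fun n => (1 - x) * Real.log x ^ 6 * (x ^ 6) ^ n := by
    ext n; simp only [F, ← pow_mul]; ring
  simp only [this, hg.tsum_eq]
  ring

lemma aux_res {f : ℕ → ℝ} (hf : Summable f) : ∑' n, f n =
    ∑' m, f (0 + 6 * m) + ∑' m, f (1 + 6 * m) + ∑' m, f (2 + 6 * m) + ∑' m, f (3 + 6 * m)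
      + ∑' m, f (4 + 6 * m) + ∑' m, f (5 + 6 * m) := by
  rw [Nat.sumByResidueClasses hf 6]
  exact Fin.sum_univ_six (fun j : Fin 6 => ∑' m, f (j.val + 6 * m))

lemma aux_scale (c : ℕ) : ∑' n, aux_u (c * n) = (∑' n, aux_u n) / (c:ℝ) ^ 7 := by
  rw [← tsum_div_const]
  congr 1; ext n
  simp only [aux_u]; push_cast
  rw [mul_pow, one_div, one_div, mul_inv]; ring

lemma aux_two : ∑' n, aux_u (2 * n) =
    ∑' m, aux_u (0 + 6 * m) + ∑' m, aux_u (2 + 6 * m) + ∑' m, aux_u (4 + 6 * m) := by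
  have hs : Summable (fun n => aux_u (2 * n)) :=
    aux_u_summable.comp_injective (fun a b h => by simpa using h)
  rw [Nat.sumByResidueClasses hs 3]
  refine (Fin.sum_univ_three (fun j : Fin 3 => ∑' m, aux_u (2 * (j.val + 3 * m)))).trans ?_
  simp only [mul_add, ← mul_assoc]
  norm_num

lemma aux_three : ∑' n, aux_u (3 * n) =
    ∑' m, aux_u (0 + 6 * m) + ∑' m, aux_u (3 + 6 * m) := by
  have hs : Summable (fun n => aux_u (3 * n)) :=
    aux_u_summable.comp_injective (fun a b h => by simpa using h)
  rw [Nat.sumByResidueClasses hs 2]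
  refine (Fin.sum_univ_two (fun j : Fin 2 => ∑' m, aux_u (3 * (j.val + 2 * m)))).trans ?_
  simp only [mul_add, ← mul_assoc]
  norm_num

lemma aux_bern : (Polynomial.map (algebraMap ℚ ℝ) (Polynomial.bernoulli 7)).eval (1/3) =
    49 / 2187 := by
  have h3 : (1 / 3 : ℝ) = (algebraMap ℚ ℝ) (1 / 3 : ℚ) := by simp
  have b0 : bernoulli 0 = 1 := by simp
  have b2 : bernoulli 2 = 1 / 6 := by simp
  have b3 : bernoulli 3 = 0 := bernoulli_eq_zero_of_odd (by decide) (by norm_num)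
  have b5 : bernoulli 5 = 0 := bernoulli_eq_zero_of_odd (by decide) (by norm_num)
  have b7 : bernoulli 7 = 0 := bernoulli_eq_zero_of_odd (by decide) (by norm_num)
  have b4 : bernoulli 4 = -1 / 30 := by
    rw [bernoulli_eq_bernoulli'_of_ne_one (by norm_num), bernoulli'_four]
  have b6 : bernoulli 6 = 1 / 42 := by
    have := sum_bernoulli 7
    norm_num [Finset.sum_range_succ, b0, b2, b3, b4, b5, bernoulli_one, Nat.choose] at this
    linarith
  have hq : (Polynomial.bernoulli 7).eval (1 / 3 : ℚ) = 49 / 2187 := by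
    simp only [Polynomial.bernoulli, Finset.sum_range_succ, Finset.sum_range_zero,
      Polynomial.eval_add, Polynomial.eval_monomial, Polynomial.eval_zero]
    norm_num [b0, b2, b3, b4, b5, b6, b7, bernoulli_one, Nat.choose]
  rw [h3, Polynomial.eval_map, Polynomial.eval₂_at_apply, hq]
  norm_num

lemma aux_sin (j : ℕ) : ∑' m, (aux_u (j + 6 * m) * Real.sin (2 * Real.pi * (j + 6 * m : ℕ) * (1/3)))
    = Real.sin (2 * Real.pi * j / 3) * ∑' m, aux_u (j + 6 * m) := by
  rw [← tsum_mul_left]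
  congr 1; ext m
  rw [show 2 * Real.pi * (j + 6 * m : ℕ) * (1/3) = 2 * Real.pi * j / 3 + (2 * m : ℕ) * (2 * Real.pi) by
    push_cast; ring, Real.sin_add_nat_mul_two_pi]
  ring

lemma aux_T : (2 * Real.pi) ^ 7 / 2 / 5040 * (49 / 2187) =
    Real.sqrt 3 / 2 * (∑' m, aux_u (1 + 6 * m) - ∑' m, aux_u (2 + 6 * m)
      + ∑' m, aux_u (4 + 6 * m) - ∑' m, aux_u (5 + 6 * m)) := by
  have h : HasSum (fun n : ℕ => aux_u n * Real.sin (2 * Real.pi * n * (1/3))) _ :=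
    hasSum_one_div_nat_pow_mul_sin (k := 3) (by norm_num) (x := 1/3) (by constructor <;> norm_num)
  have h2 := h.tsum_eq
  rw [aux_res h.summable] at h2
  simp only [aux_sin] at h2
  rw [show 2 * 3 + 1 = 7 from rfl, aux_bern] at h2
  have s0 : Real.sin (2 * Real.pi * (0:ℕ) / 3) = 0 := by simp
  have s1 : Real.sin (2 * Real.pi * (1:ℕ) / 3) = Real.sqrt 3 / 2 := by
    rw [show 2 * Real.pi * (1:ℕ) / 3 = Real.pi - Real.pi / 3 by push_cast; ring, Real.sin_pi_sub,
      Real.sin_pi_div_three]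
  have s2 : Real.sin (2 * Real.pi * (2:ℕ) / 3) = -(Real.sqrt 3 / 2) := by
    rw [show 2 * Real.pi * (2:ℕ) / 3 = Real.pi / 3 + Real.pi by push_cast; ring, Real.sin_add_pi,
      Real.sin_pi_div_three]
  have s3 : Real.sin (2 * Real.pi * (3:ℕ) / 3) = 0 := by
    rw [show 2 * Real.pi * (3:ℕ) / 3 = 2 * Real.pi by push_cast; ring, Real.sin_two_pi]
  have s4 : Real.sin (2 * Real.pi * (4:ℕ) / 3) = Real.sqrt 3 / 2 := by
    rw [← s1, ← Real.sin_add_two_pi (2 * Real.pi * (1:ℕ) / 3)]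
    congr 1; push_cast; ring
  have s5 : Real.sin (2 * Real.pi * (5:ℕ) / 3) = -(Real.sqrt 3 / 2) := by
    rw [← s2, ← Real.sin_add_two_pi (2 * Real.pi * (2:ℕ) / 3)]
    congr 1; push_cast; ring
  rw [s0, s1, s2, s3, s4, s5] at h2
  have hf : ((Nat.factorial 7 : ℕ) : ℝ) = 5040 := by norm_num [Nat.factorial]
  rw [hf] at h2
  linear_combination -h2

theorem stmt17 :
    ∫ x in (0:ℝ)..1, (1 - x) / (1 - x ^ 6) * Real.log x ^ 6 =
      7 * (256 * Real.sqrt 3 * Real.pi ^ 7 + 1327995 * ∑' k : ℕ, 1 / ((k : ℝ) + 1) ^ 7) /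
        26244 := by
  have hz : ∑' k : ℕ, 1 / ((k : ℝ) + 1) ^ 7 = ∑' n, aux_u n := by
    rw [aux_u_summable.tsum_eq_zero_add]
    simp [aux_u]
  rw [aux_integral, hz]
  have h1 := aux_res aux_u_summable
  have h2 := aux_two
  have h3 := aux_three
  have h6 := aux_scale 6
  rw [aux_scale] at h2 h3
  have hT := aux_T
  have hq : Real.sqrt 3 * Real.sqrt 3 = 3 := Real.mul_self_sqrt (by norm_num)
  have h0 : ∑' m, aux_u (0 + 6 * m) = (∑' n, aux_u n) / ((6:ℕ):ℝ) ^ 7 := by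
    rw [← h6]; simp only [zero_add]
  rw [h0] at h1 h2 h3
  generalize (∑' n, aux_u n) = Z at *
  generalize (∑' n, aux_u (1 + 6 * n)) = S1 at *
  generalize (∑' n, aux_u (2 + 6 * n)) = S2 at *
  generalize (∑' n, aux_u (3 + 6 * n)) = S3 at *
  generalize (∑' n, aux_u (4 + 6 * n)) = S4 at *
  generalize (∑' n, aux_u (5 + 6 * n)) = S5 at *
  have hT' : S1 - S2 + S4 - S5 =
      Real.sqrt 3 * (2 / 3) * ((2 * Real.pi) ^ 7 / 2 / 5040 * (49 / 2187)) := by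
    rw [hT]; linear_combination (-(S1 - S2 + S4 - S5) / 3) * hq
  push_cast at h1 h2 h3
  linear_combination 360 * hT' - 360 * h1 + 720 * h2 + 360 * h3
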